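/- For every smooth matrix field S : ℝ³ → ℝ^{3×3} one has 2 Div(sym Rot S) = rot Div(S^⊤) = −2 Div(skw Rot S). -/

import Mathlib

open Matrix

noncomputable section

/-- Points of `ℝ³`. -/
abbrev V3 := Fin 3 → ℝ
/-- Real `3×3` matrices. -/
abbrev M3 := Matrix (Fin 3) (Fin 3) ℝ

/-- Partial derivative `∂ᵢ f` of a scalar function on `ℝ³`. -/
def pd (i : Fin 3) (f : V3 → ℝ) (x : V3) : ℝ := fderiv ℝ f x (Pi.single i 1)

/-- Gradient of a scalar function. -/
def grad (f : V3 → ℝ) (x : V3) : V3 := fun i => pd i f x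

/-- Divergence of a vector field. -/
def vdiv (v : V3 → V3) (x : V3) : ℝ := ∑ i, pd i (fun y => v y i) x

/-- Curl (rotation) of a vector field. -/
def vrot (v : V3 → V3) (x : V3) : V3 :=
  ![pd 1 (fun y => v y 2) x - pd 2 (fun y => v y 1) x,
    pd 2 (fun y => v y 0) x - pd 0 (fun y => v y 2) x,
    pd 0 (fun y => v y 1) x - pd 1 (fun y => v y 0) x]

/-- Jacobian matrix `(Grad v)_{ij} = ∂_j v_i` of a vector field. -/
def vGrad (v : V3 → V3) (x : V3) : M3 := Matrix.of fun i j => pd j (fun y => v y i) x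

/-- Row-wise curl of a matrix field. -/
def mRot (S : V3 → M3) (x : V3) : M3 := Matrix.of fun i => vrot (fun y => S y i) x

/-- Row-wise divergence of a matrix field. -/
def mDiv (S : V3 → M3) (x : V3) : V3 := fun i => vdiv (fun y => S y i) x

/-- The second order operator `RotRot^⊤ S = Rot ((Rot S)ᵀ)`. -/
def rotRotT (S : V3 → M3) (x : V3) : M3 := mRot (fun y => (mRot S y)ᵀ) x

/-- Symmetric part of a matrix. -/
def msym (M : M3) : M3 := (2⁻¹ : ℝ) • (M + Mᵀ)

/-- Skew-symmetric part of a matrix. -/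
def mskw (M : M3) : M3 := (2⁻¹ : ℝ) • (M - Mᵀ)

/-- Deviatoric (trace-free) part of a matrix. -/
def mdev (M : M3) : M3 := M - (Matrix.trace M / 3) • (1 : M3)

/-- The skew-symmetric matrix `spn w` with `(spn w) x = w × x`. -/
def spn (w : V3) : M3 := !![0, -w 2, w 1; w 2, 0, -w 0; -w 1, w 0, 0]

/-- The axial vector of a (skew-symmetric) matrix; inverse of `spn`. -/
def spnInv (M : M3) : V3 := ![M 2 1, M 0 2, M 1 0]

end

theorem pd_add {i : Fin 3} {f g : V3 → ℝ} {x : V3} (hf : DifferentiableAt ℝ f x)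
    (hg : DifferentiableAt ℝ g x) : pd i (fun y => f y + g y) x = pd i f x + pd i g x := by
  simp [pd, fderiv_fun_add hf hg]

theorem pd_sub {i : Fin 3} {f g : V3 → ℝ} {x : V3} (hf : DifferentiableAt ℝ f x)
    (hg : DifferentiableAt ℝ g x) : pd i (fun y => f y - g y) x = pd i f x - pd i g x := by
  simp [pd, fderiv_fun_sub hf hg]

theorem pd_const_mul {i : Fin 3} {f : V3 → ℝ} {x : V3} (hf : DifferentiableAt ℝ f x) (c : ℝ) :
    pd i (fun y => c * f y) x = c * pd i f x := by
  simp [pd, fderiv_const_mul hf]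

theorem differentiable_pd {f : V3 → ℝ} (hf : ContDiff ℝ 2 f) (i : Fin 3) :
    Differentiable ℝ (pd i f) :=
  ((hf.fderiv_right (m := 1) (by norm_num)).differentiable (by norm_num)).clm_apply
    (differentiable_const _)

/-- Partial derivatives of a `C²` function commute. -/
theorem pd_comm {f : V3 → ℝ} (hf : ContDiff ℝ 2 f) (i j : Fin 3) (x : V3) :
    pd i (pd j f) x = pd j (pd i f) x := by
  have hd : DifferentiableAt ℝ (fderiv ℝ f) x :=
    (hf.fderiv_right (m := 1) (by norm_num)).differentiable (by norm_num) x
  have key (a b : Fin 3) : pd a (pd b f) x =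
      fderiv ℝ (fderiv ℝ f) x (Pi.single a 1) (Pi.single b 1) := by
    have h := hd.hasFDerivAt.clm_apply
      (hasFDerivAt_const (Pi.single b 1 : V3) x)
    change fderiv ℝ (fun y => fderiv ℝ f y (Pi.single b 1)) x _ = _
    rw [h.fderiv]
    simp
  rw [key, key]
  exact (hf.contDiffAt.isSymmSndFDerivAt (by simp)).eq _ _

/-- The curl of a `C²` vector field is divergence free. -/
theorem vdiv_vrot {v : V3 → V3} (hv : ∀ i, ContDiff ℝ 2 fun y => v y i) (x : V3) :
    vdiv (vrot v) x = 0 := by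
  have d (i j : Fin 3) := (differentiable_pd (hv j) i).differentiableAt (x := x)
  simp only [vdiv, vrot, Fin.sum_univ_three, cons_val]
  rw [pd_sub (d _ _) (d _ _), pd_sub (d _ _) (d _ _), pd_sub (d _ _) (d _ _),
    pd_comm (hv 2) 1 0, pd_comm (hv 1) 2 0, pd_comm (hv 0) 2 1]
  ring

theorem differentiable_vrot {v : V3 → V3} (hv : ∀ i, ContDiff ℝ 2 fun y => v y i) (i : Fin 3) :
    Differentiable ℝ fun y => vrot v y i := by
  have d (i j : Fin 3) := differentiable_pd (hv j) i
  fin_cases i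
  · exact (d 1 2).sub (d 2 1)
  · exact (d 2 0).sub (d 0 2)
  · exact (d 0 1).sub (d 1 0)

theorem mDiv_mRot {S : V3 → M3} (hS : ∀ i j, ContDiff ℝ 2 fun y => S y i j) (x : V3) :
    mDiv (mRot S) x = 0 :=
  funext fun i => vdiv_vrot (hS i) x

theorem mDiv_transpose_mRot {S : V3 → M3} (hS : ∀ i j, ContDiff ℝ 2 fun y => S y i j) (x : V3) :
    mDiv (fun y => (mRot S y)ᵀ) x = vrot (mDiv fun z => (S z)ᵀ) x := by
  have d (k i j : Fin 3) := (differentiable_pd (hS i j) k).differentiableAt (x := x)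
  have pd_div (k i : Fin 3) : pd k (fun y => ∑ j, pd j (fun z => S z j i) y) x =
      ∑ j, pd j (pd k fun y => S y j i) x := by
    simp only [Fin.sum_univ_three]
    rw [pd_add ((d _ _ _).fun_add (d _ _ _)) (d _ _ _), pd_add (d _ _ _) (d _ _ _),
      pd_comm (hS 0 i) 0, pd_comm (hS 1 i) 1, pd_comm (hS 2 i) 2]
  have pd_curl (a b k l i j : Fin 3) :
      pd k (fun y => pd a (fun z => S z i b) y - pd l (fun z => S z i j) y) x =
        pd k (pd a fun z => S z i b) x - pd k (pd l fun z => S z i j) x :=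
    pd_sub (d _ _ _) (d _ _ _)
  ext i
  fin_cases i <;>
    simp [vrot, pd_div, Finset.sum_sub_distrib, pd_curl, mDiv, vdiv, mRot]

theorem mDiv_msym {T : V3 → M3} {x : V3} (hT : ∀ i j, DifferentiableAt ℝ (fun y => T y i j) x) :
    mDiv (fun y => msym (T y)) x = (2⁻¹ : ℝ) • (mDiv T x + mDiv (fun y => (T y)ᵀ) x) := by
  ext i
  simp only [mDiv, vdiv, msym, Matrix.smul_apply, Matrix.add_apply, transpose_apply, smul_eq_mul,
    Pi.smul_apply, Pi.add_apply, ← Finset.sum_add_distrib, Finset.mul_sum]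
  refine Finset.sum_congr rfl fun j _ => ?_
  rw [pd_const_mul ((hT i j).fun_add (hT j i)), pd_add (hT i j) (hT j i)]

theorem mDiv_mskw {T : V3 → M3} {x : V3} (hT : ∀ i j, DifferentiableAt ℝ (fun y => T y i j) x) :
    mDiv (fun y => mskw (T y)) x = (2⁻¹ : ℝ) • (mDiv T x - mDiv (fun y => (T y)ᵀ) x) := by
  ext i
  simp only [mDiv, vdiv, mskw, Matrix.smul_apply, Matrix.sub_apply, transpose_apply, smul_eq_mul,
    Pi.smul_apply, Pi.sub_apply, ← Finset.sum_sub_distrib, Finset.mul_sum]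
  refine Finset.sum_congr rfl fun j _ => ?_
  rw [pd_const_mul ((hT i j).fun_sub (hT j i)), pd_sub (hT i j) (hT j i)]

/-- `2 Div (sym Rot S) = rot Div Sᵀ = -2 Div (skw Rot S)`. -/
theorem two_mDiv_msym_mRot (S : V3 → M3)
    (hS : ∀ i j, ContDiff ℝ (⊤ : ℕ∞) fun y => S y i j) :
    ∀ x, (2 : ℝ) • mDiv (fun y => msym (mRot S y)) x =
        vrot (fun y => mDiv (fun z => (S z)ᵀ) y) x ∧
      vrot (fun y => mDiv (fun z => (S z)ᵀ) y) x =
        (-2 : ℝ) • mDiv (fun y => mskw (mRot S y)) x := by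
  intro x
  have hS₂ (i j : Fin 3) : ContDiff ℝ 2 fun y => S y i j :=
    (hS i j).of_le (WithTop.coe_le_coe.2 le_top)
  have hd (i j : Fin 3) : DifferentiableAt ℝ (fun y => mRot S y i j) x :=
    differentiable_vrot (hS₂ i) j x
  rw [mDiv_msym hd, mDiv_mskw hd, mDiv_mRot hS₂, mDiv_transpose_mRot hS₂]
  simp [smul_smul]
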